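/- Let G be a countable amenable group, let (X, 𝒳, μ) be a probability space, and let T⁽¹⁾, …, T⁽ᵈ⁾ be pairwise commuting measure-preserving actions of G on X. Let f be a nonnegative bounded measurable function on X. Then for every c > 0, the set R = {(g₁, …, g_d) ∈ Gᵈ : ∫ ∏_{ε ∈ {0,1}ᵈ} f ∘ ∏_{i=1}^d (T⁽ⁱ⁾_{g_i})^{ε_i} dμ > (∫ f dμ)^{2^d} − c} is both left syndetic and right syndetic in Gᵈ. -/

import Mathlib

open MeasureTheory Filter Topology

/-- A left Følner sequence: finite nonempty sets with `|Φ N ∩ gΦ N|/|Φ N| → 1` for all `g`. -/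
def IsLeftFolner {G : Type*} [Group G] [DecidableEq G] (Φ : ℕ → Finset G) : Prop :=
  (∀ N, (Φ N).Nonempty) ∧
    ∀ g : G, Tendsto
      (fun N => (((Φ N) ∩ (Φ N).image (fun x => g * x)).card : ℝ) / ((Φ N).card : ℝ))
      atTop (𝓝 1)

/-- A right Følner sequence: finite nonempty sets with `|Φ N ∩ Φ N g|/|Φ N| → 1` for all `g`. -/
def IsRightFolner {G : Type*} [Group G] [DecidableEq G] (Φ : ℕ → Finset G) : Prop :=
  (∀ N, (Φ N).Nonempty) ∧
    ∀ g : G, Tendsto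
      (fun N => (((Φ N) ∩ (Φ N).image (fun x => x * g)).card : ℝ) / ((Φ N).card : ℝ))
      atTop (𝓝 1)

/-- A two-sided Følner sequence is both a left and a right Følner sequence. -/
def IsTwoSidedFolner {G : Type*} [Group G] [DecidableEq G] (Φ : ℕ → Finset G) : Prop :=
  IsLeftFolner Φ ∧ IsRightFolner Φ
/-- `S` is left syndetic: finitely many left translates of `S` cover the group. -/
def LeftSyndetic {H : Type*} [Group H] (S : Set H) : Prop :=
  ∃ F : Finset H, ∀ x : H, ∃ g ∈ F, g⁻¹ * x ∈ S

/-- `S` is right syndetic: finitely many right translates of `S` cover the group. -/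
def RightSyndetic {H : Type*} [Group H] (S : Set H) : Prop :=
  ∃ F : Finset H, ∀ x : H, ∃ g ∈ F, x * g⁻¹ ∈ S
/-- `cubeMap T g ε = ∏ i, (T i (g i))^(ε i)` : the composition, over all `i` with `ε i = true`,
of the maps `T i (g i)` (the actions commute, so the order is immaterial). -/
def cubeMap {G X : Type*} {d : ℕ} (T : Fin d → G → X → X) (g : Fin d → G)
    (ε : Fin d → Bool) : X → X :=
  fun x => (List.ofFn (fun i : Fin d => if ε i then T i (g i) else id)).foldr (· ∘ ·) id x


section WeightedSums

/-- The sum of `φ` with finitely supported weights `a`. -/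
noncomputable def wsum {α : Type*} (a : α →₀ ℝ) (φ : α → ℝ) : ℝ :=
  Finsupp.linearCombination ℝ φ a

/-- A finitely supported probability weight. -/
structure IsWeight {α : Type*} (a : α →₀ ℝ) : Prop where
  nonneg : ∀ x, 0 ≤ a x
  total : wsum a (fun _ => 1) = 1

variable {α β : Type*}

lemma wsum_eq_sum (a : α →₀ ℝ) (φ : α → ℝ) : wsum a φ = ∑ x ∈ a.support, a x * φ x := by
  simp [wsum, Finsupp.linearCombination_apply, Finsupp.sum]

lemma wsum_add_left (a b : α →₀ ℝ) (φ : α → ℝ) : wsum (a + b) φ = wsum a φ + wsum b φ := by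
  simp [wsum]

lemma wsum_sub_left (a b : α →₀ ℝ) (φ : α → ℝ) : wsum (a - b) φ = wsum a φ - wsum b φ := by
  simp [wsum]

lemma wsum_smul_left (s : ℝ) (a : α →₀ ℝ) (φ : α → ℝ) : wsum (s • a) φ = s * wsum a φ := by
  simp [wsum]

lemma wsum_single (x : α) (φ : α → ℝ) : wsum (Finsupp.single x 1) φ = φ x := by
  simp [wsum]

lemma wsum_mapDomain (e : α → β) (a : α →₀ ℝ) (φ : β → ℝ) :
    wsum (a.mapDomain e) φ = wsum a (fun x => φ (e x)) := by
  simp [wsum, Finsupp.linearCombination_mapDomain, Function.comp_def]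

lemma wsum_add_right (a : α →₀ ℝ) (φ ψ : α → ℝ) :
    wsum a (fun x => φ x + ψ x) = wsum a φ + wsum a ψ := by
  simp [wsum_eq_sum, mul_add, Finset.sum_add_distrib]

lemma wsum_sub_right (a : α →₀ ℝ) (φ ψ : α → ℝ) :
    wsum a (fun x => φ x - ψ x) = wsum a φ - wsum a ψ := by
  simp [wsum_eq_sum, mul_sub, Finset.sum_sub_distrib]

lemma wsum_const_mul (a : α →₀ ℝ) (s : ℝ) (φ : α → ℝ) :
    wsum a (fun x => s * φ x) = s * wsum a φ := by
  simp only [wsum_eq_sum, Finset.mul_sum]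
  exact Finset.sum_congr rfl fun x _ => by ring

lemma wsum_mul_const (a : α →₀ ℝ) (s : ℝ) (φ : α → ℝ) :
    wsum a (fun x => φ x * s) = wsum a φ * s := by
  simp only [mul_comm _ s, wsum_const_mul]

lemma wsum_comm (a : α →₀ ℝ) (b : β →₀ ℝ) (φ : α → β → ℝ) :
    wsum a (fun x => wsum b (φ x)) = wsum b (fun y => wsum a (fun x => φ x y)) := by
  simp only [wsum_eq_sum, Finset.mul_sum]
  rw [Finset.sum_comm]
  exact Finset.sum_congr rfl fun x _ => Finset.sum_congr rfl fun y _ => by ring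

lemma wsum_mono {a : α →₀ ℝ} (ha : ∀ x, 0 ≤ a x) {φ ψ : α → ℝ}
    (h : ∀ x ∈ a.support, φ x ≤ ψ x) : wsum a φ ≤ wsum a ψ := by
  simp only [wsum_eq_sum]
  exact Finset.sum_le_sum fun x hx => mul_le_mul_of_nonneg_left (h x hx) (ha x)

lemma wsum_nonneg {a : α →₀ ℝ} (ha : ∀ x, 0 ≤ a x) {φ : α → ℝ} (h : ∀ x, 0 ≤ φ x) :
    0 ≤ wsum a φ := by
  rw [wsum_eq_sum]
  exact Finset.sum_nonneg fun x _ => mul_nonneg (ha x) (h x)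

lemma IsWeight.wsum_const {a : α →₀ ℝ} (ha : IsWeight a) (s : ℝ) : wsum a (fun _ => s) = s := by
  have := wsum_const_mul a s (fun _ => 1)
  simpa [ha.total] using this

lemma IsWeight.abs_wsum_le {a : α →₀ ℝ} (ha : IsWeight a) {φ ψ : α → ℝ}
    (h : ∀ x, |φ x| ≤ ψ x) : |wsum a φ| ≤ wsum a ψ := by
  rw [abs_le]
  constructor
  · have h1 := wsum_mono ha.nonneg (φ := fun x => (-1) * ψ x) (ψ := φ)
      fun x _ => by have := (abs_le.1 (h x)).1; linarith
    rw [wsum_const_mul] at h1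
    linarith
  · exact wsum_mono ha.nonneg fun x _ => (abs_le.1 (h x)).2

lemma IsWeight.sq_wsum_le {a : α →₀ ℝ} (ha : IsWeight a) (φ : α → ℝ) :
    wsum a φ ^ 2 ≤ wsum a (fun x => φ x ^ 2) := by
  set c := wsum a φ with hc
  have h := wsum_mono ha.nonneg (φ := fun x => (2 * c) * φ x - c ^ 2)
    (ψ := fun x => φ x ^ 2) fun x _ => by nlinarith [sq_nonneg (φ x - c)]
  rw [wsum_sub_right, wsum_const_mul, ha.wsum_const, ← hc] at h
  linarith

lemma IsWeight.single (x : α) : IsWeight (Finsupp.single x (1 : ℝ)) := by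
  classical
  refine ⟨fun y => ?_, wsum_single x _⟩
  rw [Finsupp.single_apply]
  split_ifs <;> norm_num

lemma IsWeight.mapDomain {a : α →₀ ℝ} (ha : IsWeight a) (e : α → β) :
    IsWeight (a.mapDomain e) := by
  classical
  refine ⟨fun y => ?_, by rw [wsum_mapDomain]; exact ha.total⟩
  rw [Finsupp.mapDomain, Finsupp.sum_apply]
  refine Finset.sum_nonneg fun x _ => ?_
  change 0 ≤ Finsupp.single (e x) (a x) y
  rw [Finsupp.single_apply]
  split_ifs
  exacts [ha.nonneg x, le_rfl]

lemma IsWeight.midpoint {a b : α →₀ ℝ} (ha : IsWeight a) (hb : IsWeight b) :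
    IsWeight ((1 / 2 : ℝ) • (a + b)) := by
  refine ⟨fun x => ?_, ?_⟩
  · have := ha.nonneg x
    have := hb.nonneg x
    simp only [Finsupp.smul_apply, Finsupp.add_apply, smul_eq_mul]
    positivity
  · rw [wsum_smul_left, wsum_add_left, ha.total, hb.total]
    norm_num

end WeightedSums

section PositiveDefinite

/-- The bilinear form on finitely supported functions attached to a function on a group. -/
noncomputable def corr {H : Type*} [Group H] (p : H → ℝ) (a b : H →₀ ℝ) : ℝ :=
  wsum a fun g => wsum b fun h => p (g⁻¹ * h)

/-- Real-valued positive definite functions on a group. -/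
structure IsPosDefFun {H : Type*} [Group H] (p : H → ℝ) : Prop where
  inv : ∀ g, p g⁻¹ = p g
  nonneg : ∀ a : H →₀ ℝ, 0 ≤ corr p a a

variable {H : Type*} [Group H] {p : H → ℝ}

lemma corr_add_left (p : H → ℝ) (a b c : H →₀ ℝ) : corr p (a + b) c = corr p a c + corr p b c :=
  wsum_add_left _ _ _

lemma corr_sub_left (p : H → ℝ) (a b c : H →₀ ℝ) : corr p (a - b) c = corr p a c - corr p b c :=
  wsum_sub_left _ _ _

lemma corr_smul_left (p : H → ℝ) (s : ℝ) (a c : H →₀ ℝ) :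
    corr p (s • a) c = s * corr p a c :=
  wsum_smul_left _ _ _

lemma corr_add_right (p : H → ℝ) (a b c : H →₀ ℝ) :
    corr p a (b + c) = corr p a b + corr p a c := by
  simp only [corr, wsum_add_left, wsum_add_right]

lemma corr_sub_right (p : H → ℝ) (a b c : H →₀ ℝ) :
    corr p a (b - c) = corr p a b - corr p a c := by
  simp only [corr, wsum_sub_left, wsum_sub_right]

lemma corr_smul_right (p : H → ℝ) (s : ℝ) (a c : H →₀ ℝ) :
    corr p a (s • c) = s * corr p a c := by
  simp only [corr, wsum_smul_left, wsum_const_mul]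

lemma corr_wsum {ι : Type*} (w : ι →₀ ℝ) (p : ι → H → ℝ) (a b : H →₀ ℝ) :
    corr (fun g => wsum w fun i => p i g) a b = wsum w fun i => corr (p i) a b := by
  simp only [corr]
  rw [wsum_comm w a]
  congr 1
  ext g
  rw [wsum_comm]

lemma corr_mono {p q : H → ℝ} {a : H →₀ ℝ} (ha : ∀ x, 0 ≤ a x)
    (h : ∀ x ∈ a.support, ∀ y ∈ a.support, p (x⁻¹ * y) ≤ q (x⁻¹ * y)) :
    corr p a a ≤ corr q a a :=
  wsum_mono ha fun x hx => wsum_mono ha fun y hy => h x hx y hy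

lemma continuous_corr (a b : H →₀ ℝ) : Continuous fun p : H → ℝ => corr p a b := by
  simp only [corr, wsum_eq_sum]
  fun_prop

lemma corr_translate (p : H → ℝ) (y : H) (a : H →₀ ℝ) :
    corr p (a.mapDomain (y * ·)) (a.mapDomain (y * ·)) = corr p a a := by
  simp only [corr, wsum_mapDomain, mul_inv_rev, mul_assoc, inv_mul_cancel_left]

lemma IsPosDefFun.corr_comm (hp : IsPosDefFun p) (a b : H →₀ ℝ) : corr p a b = corr p b a := by
  rw [corr, wsum_comm, corr]
  congr 1
  ext g
  congr 1
  ext h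
  rw [← hp.inv, mul_inv_rev, inv_inv]

lemma IsPosDefFun.one_nonneg (hp : IsPosDefFun p) : 0 ≤ p 1 := by
  simpa [corr, wsum_single] using hp.nonneg (Finsupp.single 1 1)

lemma IsPosDefFun.le_one (hp : IsPosDefFun p) (g : H) : p g ≤ p 1 := by
  have h := hp.nonneg (Finsupp.single 1 1 - Finsupp.single g 1)
  rw [corr_sub_left, corr_sub_right, corr_sub_right] at h
  simp only [corr, wsum_single] at h
  have h1 := hp.inv g
  simp only [inv_one, one_mul, mul_one, inv_mul_cancel] at h
  linarith

lemma IsPosDefFun.two_mul_corr_le (hp : IsPosDefFun p) (a b : H →₀ ℝ) :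
    2 * corr p a b ≤ corr p a a + corr p b b := by
  have h := hp.nonneg (a - b)
  rw [corr_sub_left, corr_sub_right, corr_sub_right, hp.corr_comm b a] at h
  linarith

lemma IsPosDefFun.abs_corr_le (hp : IsPosDefFun p) {δ : ℝ} (hδ : 0 < δ) (a b : H →₀ ℝ) :
    |corr p a b| ≤ δ / 2 * corr p a a + corr p b b / (2 * δ) := by
  have h1 := hp.two_mul_corr_le (δ • a) b
  have h2 := hp.two_mul_corr_le (δ • a) ((-1 : ℝ) • b)
  simp only [corr_smul_left, corr_smul_right] at h1 h2
  have e : δ / 2 * corr p a a + corr p b b / (2 * δ)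
      = (δ * (δ * corr p a a) + corr p b b) / (2 * δ) := by
    field_simp
  have hδ2 : 0 < 2 * δ := by positivity
  rw [e, abs_le, ← neg_div, div_le_iff₀ hδ2, le_div_iff₀ hδ2]
  constructor <;> linarith

/-- Near-minimizers of the quadratic form on probability weights are almost invariant. -/
lemma corr_sub_translate_le {v : H →₀ ℝ} (hv : IsWeight v) {η : ℝ}
    (hmin : ∀ v', IsWeight v' → corr p v v ≤ corr p v' v' + η) (y : H) :
    corr p (v.mapDomain (y * ·) - v) (v.mapDomain (y * ·) - v) ≤ 4 * η := by
  have h := hmin _ (hv.midpoint (hv.mapDomain (y * ·)))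
  have e := corr_translate p y v
  simp only [corr_smul_left, corr_smul_right, corr_add_left, corr_add_right, corr_sub_left,
    corr_sub_right] at h ⊢
  linarith

lemma IsPosDefFun.abs_wsum_sub_corr_le (hp : IsPosDefFun p) {v : H →₀ ℝ} (hv : IsWeight v)
    {η δ : ℝ} (hδ : 0 < δ)
    (hinv : ∀ y, corr p (v.mapDomain (y * ·) - v) (v.mapDomain (y * ·) - v) ≤ 4 * η) (y : H) :
    |wsum v (fun g => p (y * g)) - corr p v v| ≤ δ * p 1 + 4 * η / δ := by
  have key : ∀ z, |wsum v (fun g => p (z * g)) - wsum v p| ≤ δ / 2 * p 1 + 2 * η / δ := by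
    intro z
    have h := hp.abs_corr_le hδ (Finsupp.single 1 1) (v.mapDomain (z * ·) - v)
    rw [corr_sub_right] at h
    have h1 : corr p (v.mapDomain (z * ·) - v) (v.mapDomain (z * ·) - v) / (2 * δ)
        ≤ 2 * η / δ := by
      rw [div_le_div_iff₀ (by positivity) hδ]
      nlinarith [hinv z]
    simp only [corr, wsum_single, wsum_mapDomain, inv_one, one_mul] at h h1
    linarith
  have h2 : |corr p v v - wsum v p| ≤ δ / 2 * p 1 + 2 * η / δ := by
    rw [← hv.wsum_const (wsum v p), corr, ← wsum_sub_right]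
    refine (hv.abs_wsum_le fun g => key g⁻¹).trans_eq ?_
    rw [hv.wsum_const]
  have h3 := key y
  have e : 4 * η / δ = 2 * η / δ + 2 * η / δ := by ring
  rw [abs_le] at *
  constructor <;> linarith [h2.1, h2.2, h3.1, h3.2]

lemma IsPosDefFun.sum {ι : Type*} (s : Finset ι) {p : ι → H → ℝ}
    (hp : ∀ i ∈ s, IsPosDefFun (p i)) : IsPosDefFun fun g => ∑ i ∈ s, p i g := by
  classical
  refine ⟨fun g => Finset.sum_congr rfl fun i hi => (hp i hi).inv g, fun a => ?_⟩
  have : corr (fun g => ∑ i ∈ s, p i g) a a = ∑ i ∈ s, corr (p i) a a := by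
    simp only [corr, wsum_eq_sum, Finset.mul_sum]
    simp_rw [Finset.sum_comm (s := s)]
  rw [this]
  exact Finset.sum_nonneg fun i hi => (hp i hi).nonneg a

lemma IsPosDefFun.wsum {ι : Type*} {w : ι →₀ ℝ} (hw : ∀ i, 0 ≤ w i) {p : ι → H → ℝ}
    (hp : ∀ i, IsPosDefFun (p i)) : IsPosDefFun fun g => wsum w fun i => p i g := by
  refine ⟨fun g => by simp only [(hp _).inv], fun a => ?_⟩
  rw [corr_wsum]
  exact wsum_nonneg hw fun i => (hp i).nonneg a

lemma isClosed_setOf_isPosDefFun : IsClosed {p : H → ℝ | IsPosDefFun p} := by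
  have : {p : H → ℝ | IsPosDefFun p}
      = (⋂ g : H, {p : H → ℝ | p g⁻¹ = p g}) ∩ ⋂ a : H →₀ ℝ, {p : H → ℝ | 0 ≤ corr p a a} := by
    ext p
    simp only [Set.mem_ofPred_eq, Set.mem_inter_iff, Set.mem_iInter]
    exact ⟨fun h => ⟨h.1, h.2⟩, fun h => ⟨h.1, h.2⟩⟩
  rw [this]
  exact (isClosed_iInter fun g : H => isClosed_eq (continuous_apply g⁻¹) (continuous_apply g)).inter
    (isClosed_iInter fun a : H →₀ ℝ => isClosed_le continuous_const (continuous_corr a a))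

/-- The infimum of the quadratic form over probability weights. -/
noncomputable def infCorr (p : H → ℝ) : ℝ :=
  sInf ((fun v => corr p v v) '' {v | IsWeight v})

lemma IsPosDefFun.infCorr_le (hp : IsPosDefFun p) {v : H →₀ ℝ} (hv : IsWeight v) :
    infCorr p ≤ corr p v v :=
  csInf_le ⟨0, by rintro _ ⟨v, -, rfl⟩; exact hp.nonneg v⟩ ⟨v, hv, rfl⟩

lemma le_infCorr {c : ℝ} (h : ∀ v, IsWeight v → c ≤ corr p v v) : c ≤ infCorr p :=
  le_csInf ⟨_, Finsupp.single 1 1, IsWeight.single 1, rfl⟩ (by rintro _ ⟨v, hv, rfl⟩; exact h v hv)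

lemma exists_corr_le_infCorr_add (p : H → ℝ) {ε : ℝ} (hε : 0 < ε) :
    ∃ v, IsWeight v ∧ corr p v v ≤ infCorr p + ε := by
  by_contra! h
  have hne : ((fun v => corr p v v) '' {v | IsWeight v}).Nonempty :=
    ⟨_, Finsupp.single 1 1, IsWeight.single 1, rfl⟩
  obtain ⟨_, ⟨v, hv, rfl⟩, h1⟩ := exists_lt_of_csInf_lt hne
    (show sInf ((fun v => corr p v v) '' {v | IsWeight v}) < infCorr p + ε by
      rw [infCorr]; linarith)
  exact absurd (h v hv) (not_lt.2 h1.le)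

/-- Finitely many positive definite functions have common near-minimizers. -/
lemma exists_weight_forall_corr_le {ι : Type*} (s : Finset ι) (p : ι → H → ℝ)
    (hp : ∀ i ∈ s, IsPosDefFun (p i)) {ε : ℝ} (hε : 0 < ε) :
    ∃ v, IsWeight v ∧ ∀ i ∈ s, corr (p i) v v ≤ infCorr (p i) + ε := by
  have hq := IsPosDefFun.sum s hp
  set q : H → ℝ := fun g => ∑ i ∈ s, p i g with hqdef
  have hcorr : ∀ a, corr q a a = ∑ i ∈ s, corr (p i) a a := fun a => by
    simp only [hqdef, corr, wsum_eq_sum, Finset.mul_sum]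
    simp_rw [Finset.sum_comm (s := s)]
  have hq1 := hq.one_nonneg
  set δ : ℝ := ε / (4 * (q 1 + 1)) with hδdef
  have hδ : 0 < δ := by positivity
  obtain ⟨v, hv, hvmin⟩ := exists_corr_le_infCorr_add q (show 0 < δ * ε / 16 by positivity)
  refine ⟨v, hv, fun i hi => ?_⟩
  have hpi := hp i hi
  have hinv : ∀ y, corr (p i) (v.mapDomain (y * ·) - v) (v.mapDomain (y * ·) - v)
      ≤ 4 * (δ * ε / 16) := fun y => by
    refine le_trans ?_ (corr_sub_translate_le hv
      (fun v' hv' => hvmin.trans (by linarith [hq.infCorr_le hv'])) y)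
    rw [hcorr]
    exact Finset.single_le_sum (f := fun i => corr (p i) _ _)
      (fun j hj => (hp j hj).nonneg _) hi
  have hosc := hpi.abs_wsum_sub_corr_le hv hδ hinv
  have hpq : p i 1 ≤ q 1 :=
    Finset.single_le_sum (f := fun i => p i 1) (fun j hj => (hp j hj).one_nonneg) hi
  have hb : δ * p i 1 + 4 * (δ * ε / 16) / δ ≤ ε / 2 := by
    have h1 : 4 * (δ * ε / 16) / δ = ε / 4 := by field_simp; norm_num
    have h2 : δ * (q 1 + 1) = ε / 4 := by rw [hδdef]; field_simp
    nlinarith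
  refine sub_le_iff_le_add.1 (le_infCorr fun v' hv' => ?_)
  have h1 : corr (p i) v v - ε / 2 ≤ corr (p i) v' v := by
    rw [← hv'.wsum_const (corr (p i) v v - ε / 2)]
    exact wsum_mono hv'.nonneg fun g _ => by linarith [(abs_le.1 (hosc g⁻¹)).1]
  linarith [hpi.two_mul_corr_le v' v]

end PositiveDefinite

section SeparatelyPositiveDefinite

variable {G : Type*}

/-- The product of weights on `G` and on `Fin d → G`. -/
noncomputable def consWeight {d : ℕ} (v : G →₀ ℝ) (u : (Fin d → G) →₀ ℝ) :
    (Fin (d + 1) → G) →₀ ℝ :=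
  v.sum fun g s => s • u.mapDomain (fun h => (Fin.cons g h : Fin (d + 1) → G))

lemma wsum_consWeight {d : ℕ} (v : G →₀ ℝ) (u : (Fin d → G) →₀ ℝ) (F : (Fin (d + 1) → G) → ℝ) :
    wsum (consWeight v u) F
      = wsum v fun g => wsum u fun h => F (Fin.cons g h : Fin (d + 1) → G) := by
  have : ∀ g, wsum u (fun h => F (Fin.cons g h : Fin (d + 1) → G))
      = wsum (u.mapDomain (fun h => (Fin.cons g h : Fin (d + 1) → G))) F :=
    fun g => (wsum_mapDomain _ _ _).symm
  simp only [this]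
  simp [wsum, consWeight, Finsupp.linearCombination_apply (v := _) (l := v), map_finsuppSum]

variable [Group G]

/-- Products of probability weights, one for each coordinate. -/
def IsProdWeight : (d : ℕ) → ((Fin d → G) →₀ ℝ) → Prop
  | 0, w => w = Finsupp.single 1 1
  | _ + 1, w => ∃ v u, IsWeight v ∧ IsProdWeight _ u ∧ w = consWeight v u

/-- Nonnegative in arity zero, and otherwise positive definite in each coordinate. -/
def SepPosDef : (d : ℕ) → ((Fin d → G) → ℝ) → Prop
  | 0, F => 0 ≤ F 1
  | d + 1, F => (∀ h : Fin d → G, IsPosDefFun fun g => F (Fin.cons g h : Fin (d + 1) → G)) ∧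
      ∀ g : G, SepPosDef d fun h => F (Fin.cons g h : Fin (d + 1) → G)

lemma IsProdWeight.isWeight {d : ℕ} {w : (Fin d → G) →₀ ℝ} (hw : IsProdWeight d w) :
    IsWeight w := by
  induction d with
  | zero => rw [hw]; exact IsWeight.single 1
  | succ d ih =>
    obtain ⟨v, u, hv, hu, rfl⟩ := hw
    refine ⟨fun x => ?_, ?_⟩
    · rw [consWeight, Finsupp.sum_apply]
      exact Finset.sum_nonneg fun g _ =>
        mul_nonneg (hv.nonneg g) (((ih hu).mapDomain _).nonneg x)
    · rw [wsum_consWeight, (ih hu).total, hv.total]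

lemma cons_inv_mul_cons {d : ℕ} (g g' : G) (h h' : Fin d → G) :
    (Fin.cons g h : Fin (d + 1) → G)⁻¹ * (Fin.cons g' h' : Fin (d + 1) → G)
      = (Fin.cons (g⁻¹ * g') (h⁻¹ * h') : Fin (d + 1) → G) := by
  ext i
  refine Fin.cases ?_ (fun j => ?_) i <;> simp

lemma mul_cons {d : ℕ} (x : Fin (d + 1) → G) (g : G) (h : Fin d → G) :
    x * (Fin.cons g h : Fin (d + 1) → G)
      = (Fin.cons (x 0 * g) ((fun i => x i.succ) * h) : Fin (d + 1) → G) := by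
  ext i
  refine Fin.cases ?_ (fun j => ?_) i <;> simp

/-- Integrate out the first coordinate with the weight `v` convolved with its reflection. -/
noncomputable def headCorr {d : ℕ} (F : (Fin (d + 1) → G) → ℝ) (v : G →₀ ℝ) (h : Fin d → G) : ℝ :=
  corr (fun g => F (Fin.cons g h : Fin (d + 1) → G)) v v

/-- The infimum of `headCorr` over all weights. -/
noncomputable def headInf {d : ℕ} (F : (Fin (d + 1) → G) → ℝ) (h : Fin d → G) : ℝ :=
  infCorr fun g => F (Fin.cons g h : Fin (d + 1) → G)

lemma corr_consWeight {d : ℕ} (F : (Fin (d + 1) → G) → ℝ) (v : G →₀ ℝ) (u : (Fin d → G) →₀ ℝ) :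
    corr F (consWeight v u) (consWeight v u) = corr (headCorr F v) u u := by
  simp only [corr, wsum_consWeight, cons_inv_mul_cons, headCorr]
  rw [wsum_comm]
  congr 1
  ext h
  rw [wsum_comm u v]
  simp only [wsum_comm u v]

lemma SepPosDef.wsum {d : ℕ} {ι : Type*} {w : ι →₀ ℝ} (hw : ∀ i, 0 ≤ w i)
    {F : ι → (Fin d → G) → ℝ} (hF : ∀ i, SepPosDef d (F i)) :
    SepPosDef d fun h => wsum w fun i => F i h := by
  induction d with
  | zero => exact wsum_nonneg hw fun i => hF i
  | succ d ih =>
    exact ⟨fun h => IsPosDefFun.wsum hw fun i => (hF i).1 h,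
      fun g => ih fun i => (hF i).2 g⟩

lemma isClosed_setOf_sepPosDef (d : ℕ) : IsClosed {F : (Fin d → G) → ℝ | SepPosDef d F} := by
  induction d with
  | zero => exact isClosed_le continuous_const (continuous_apply _)
  | succ d ih =>
    have : {F : (Fin (d + 1) → G) → ℝ | SepPosDef (d + 1) F}
        = (⋂ h : Fin d → G, (fun F (g : G) => F (Fin.cons g h : Fin (d + 1) → G)) ⁻¹'
            {p | IsPosDefFun p}) ∩
          ⋂ g : G, (fun F (h : Fin d → G) => F (Fin.cons g h : Fin (d + 1) → G)) ⁻¹'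
            {F | SepPosDef d F} := by
      ext F
      simp [SepPosDef]
    rw [this]
    exact (isClosed_iInter fun h => isClosed_setOf_isPosDefFun.preimage (by fun_prop)).inter
      (isClosed_iInter fun g => ih.preimage (by fun_prop))

lemma SepPosDef.apply_inv {d : ℕ} {F : (Fin d → G) → ℝ} (hF : SepPosDef d F) (x : Fin d → G) :
    F x⁻¹ = F x := by
  induction d with
  | zero => rw [Subsingleton.elim x⁻¹ x]
  | succ d ih =>
    obtain ⟨g, h, rfl⟩ : ∃ g h, x = (Fin.cons g h : Fin (d + 1) → G) :=
      ⟨x 0, fun i => x i.succ, (Fin.cons_self_tail x).symm⟩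
    have e : (Fin.cons g h : Fin (d + 1) → G)⁻¹ = (Fin.cons g⁻¹ h⁻¹ : Fin (d + 1) → G) := by
      ext i
      refine Fin.cases ?_ (fun j => ?_) i <;> simp
    rw [e, (hF.1 h⁻¹).inv g, ih (hF.2 g) h]

lemma SepPosDef.apply_le_one {d : ℕ} {F : (Fin d → G) → ℝ} (hF : SepPosDef d F)
    (x : Fin d → G) : F x ≤ F 1 := by
  induction d with
  | zero => rw [Subsingleton.elim x 1]
  | succ d ih =>
    obtain ⟨g, h, rfl⟩ : ∃ g h, x = (Fin.cons g h : Fin (d + 1) → G) :=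
      ⟨x 0, fun i => x i.succ, (Fin.cons_self_tail x).symm⟩
    have e : (Fin.cons 1 1 : Fin (d + 1) → G) = 1 := by
      ext i
      refine Fin.cases ?_ (fun j => ?_) i <;> simp
    rw [← e]
    exact ((hF.1 h).le_one g).trans (ih (hF.2 1) h)

lemma SepPosDef.headCorr {d : ℕ} {F : (Fin (d + 1) → G) → ℝ} (hF : SepPosDef (d + 1) F)
    {v : G →₀ ℝ} (hv : IsWeight v) : SepPosDef d (headCorr F v) :=
  SepPosDef.wsum hv.nonneg fun g => SepPosDef.wsum hv.nonneg fun g' => hF.2 (g⁻¹ * g')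

lemma SepPosDef.headInf_le {d : ℕ} {F : (Fin (d + 1) → G) → ℝ} (hF : SepPosDef (d + 1) F)
    {v : G →₀ ℝ} (hv : IsWeight v) (h : Fin d → G) : headInf F h ≤ _root_.headCorr F v h :=
  (hF.1 h).infCorr_le hv

lemma SepPosDef.headInf {d : ℕ} {F : (Fin (d + 1) → G) → ℝ} (hF : SepPosDef (d + 1) F) :
    SepPosDef d (headInf F) := by
  have hex : ∀ i : Finset (Fin d → G) × ℕ, ∃ v, IsWeight v ∧ ∀ h ∈ i.1,
      _root_.headCorr F v h ≤ _root_.headInf F h + 1 / ((i.2 : ℝ) + 1) := fun i =>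
    exists_weight_forall_corr_le i.1 (fun h g => F (Fin.cons g h : Fin (d + 1) → G))
      (fun h _ => hF.1 h) (by positivity)
  choose v hv hle using hex
  classical
  have hlim : Tendsto (fun i => _root_.headCorr F (v i)) atTop (𝓝 (_root_.headInf F)) := by
    rw [tendsto_pi_nhds]
    intro h
    have hsnd : Tendsto (fun i : Finset (Fin d → G) × ℕ => _root_.headInf F h
        + 1 / ((i.2 : ℝ) + 1)) atTop (𝓝 (_root_.headInf F h + 0)) :=
      tendsto_const_nhds.add (tendsto_one_div_add_atTop_nhds_zero_nat.comp
        (by rw [← prod_atTop_atTop_eq]; exact tendsto_snd))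
    rw [add_zero] at hsnd
    refine tendsto_of_tendsto_of_tendsto_of_le_of_le' tendsto_const_nhds hsnd
      (Eventually.of_forall fun i => hF.headInf_le (hv i) h) ?_
    filter_upwards [eventually_ge_atTop (({h}, 0) : Finset (Fin d → G) × ℕ)] with i hi
    exact hle i h (hi.1 (Finset.mem_singleton_self h))
  exact (isClosed_setOf_sepPosDef d).mem_of_tendsto hlim
    (Eventually.of_forall fun i => hF.headCorr (hv i))

lemma SepPosDef.corr_nonneg {d : ℕ} {F : (Fin d → G) → ℝ} (hF : SepPosDef d F)
    {u : (Fin d → G) →₀ ℝ} (hu : IsProdWeight d u) : 0 ≤ corr F u u := by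
  induction d with
  | zero =>
    have hF : 0 ≤ F 1 := hF
    rw [hu]
    simpa [corr, wsum_single] using hF
  | succ d ih =>
    obtain ⟨v, u, hv, hu, rfl⟩ := hu
    rw [corr_consWeight]
    exact ih (hF.headCorr hv) hu

lemma exists_isProdWeight (d : ℕ) : ∃ u : (Fin d → G) →₀ ℝ, IsProdWeight d u := by
  induction d with
  | zero => exact ⟨_, rfl⟩
  | succ d ih =>
    obtain ⟨u, hu⟩ := ih
    exact ⟨_, Finsupp.single 1 1, u, IsWeight.single 1, hu, rfl⟩

/-- The mean value of a separately positive definite function. -/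
noncomputable def meanVal (d : ℕ) (F : (Fin d → G) → ℝ) : ℝ :=
  sInf ((fun u => corr F u u) '' {u | IsProdWeight d u})

lemma SepPosDef.meanVal_le {d : ℕ} {F : (Fin d → G) → ℝ} (hF : SepPosDef d F)
    {u : (Fin d → G) →₀ ℝ} (hu : IsProdWeight d u) : meanVal d F ≤ corr F u u :=
  csInf_le ⟨0, by rintro _ ⟨u, hu, rfl⟩; exact hF.corr_nonneg hu⟩ ⟨u, hu, rfl⟩

lemma le_meanVal {d : ℕ} {F : (Fin d → G) → ℝ} {c : ℝ}
    (h : ∀ u, IsProdWeight d u → c ≤ corr F u u) : c ≤ meanVal d F := by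
  obtain ⟨u, hu⟩ := exists_isProdWeight (G := G) d
  exact le_csInf ⟨_, u, hu, rfl⟩ (by rintro _ ⟨u, hu, rfl⟩; exact h u hu)

lemma SepPosDef.meanVal_headInf_le {d : ℕ} {F : (Fin (d + 1) → G) → ℝ}
    (hF : SepPosDef (d + 1) F) : meanVal d (_root_.headInf F) ≤ meanVal (d + 1) F := by
  refine le_meanVal ?_
  rintro _ ⟨v, u, hv, hu, rfl⟩
  rw [corr_consWeight]
  exact (hF.headInf.meanVal_le hu).trans
    (corr_mono hu.isWeight.nonneg fun _ _ _ _ => hF.headInf_le hv _)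

/-- Separately positive definite functions have uniform averages, attained simultaneously for
finitely many of them. -/
theorem exists_isProdWeight_abs_wsum_sub_meanVal_le (d : ℕ) (s : Finset ((Fin d → G) → ℝ))
    (hs : ∀ F ∈ s, SepPosDef d F) {ε : ℝ} (hε : 0 < ε) :
    ∃ u, IsProdWeight d u ∧
      ∀ F ∈ s, ∀ x, |wsum u (fun k => F (x * k)) - meanVal d F| ≤ ε := by
  induction d generalizing ε with
  | zero =>
    refine ⟨_, rfl, fun F _ x => ?_⟩
    have : meanVal 0 F = F 1 := by
      simp [meanVal, IsProdWeight, corr, wsum_single]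
    rw [this, wsum_single, Subsingleton.elim (x * 1) 1, sub_self, abs_zero]
    exact hε.le
  | succ d ih =>
    classical
    obtain ⟨C, hC0, hC⟩ : ∃ C : ℝ, 0 < C ∧ ∀ F ∈ s, F 1 ≤ C := by
      refine ⟨∑ F ∈ s, |F 1| + 1, by positivity, fun F hF => ?_⟩
      have := Finset.single_le_sum (f := fun F : (Fin (d + 1) → G) → ℝ => |F 1|)
        (fun _ _ => abs_nonneg _) hF
      linarith [le_abs_self (F 1)]
    obtain ⟨δ, hδ, hδC⟩ : ∃ δ : ℝ, 0 < δ ∧ δ * C = ε / 4 :=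
      ⟨ε / (4 * C), by positivity, by field_simp⟩
    obtain ⟨ε₁, hε₁, hε₁ε, hε₁δ⟩ : ∃ ε₁ : ℝ, 0 < ε₁ ∧ 3 * ε₁ ≤ ε / 4 ∧ 16 * ε₁ / δ ≤ ε / 4 := by
      refine ⟨min (ε / 12) (δ * ε / 64), by positivity, ?_, ?_⟩
      · linarith [min_le_left (ε / 12) (δ * ε / 64)]
      · rw [div_le_iff₀ hδ]
        linarith [min_le_right (ε / 12) (δ * ε / 64)]
    obtain ⟨u₀, hu₀, h₀⟩ := ih (s.image headInf) (by
      intro F' hF'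
      obtain ⟨F, hF, rfl⟩ := Finset.mem_image.1 hF'
      exact (hs F hF).headInf) hε₁
    obtain ⟨v, hv, hvle⟩ := exists_weight_forall_corr_le
      (s ×ˢ (u₀.support ×ˢ u₀.support))
      (fun i g => i.1 (Fin.cons g (i.2.1⁻¹ * i.2.2) : Fin (d + 1) → G))
      (fun i hi => (hs i.1 (Finset.mem_product.1 hi).1).1 _) hε₁
    have hv_mean : ∀ F ∈ s, corr (headCorr F v) u₀ u₀ ≤ meanVal d (headInf F) + 2 * ε₁ := by
      intro F hF
      have h1 : corr (headCorr F v) u₀ u₀ ≤ corr (fun h => headInf F h + ε₁) u₀ u₀ :=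
        corr_mono hu₀.isWeight.nonneg fun x hx y hy =>
          hvle (F, x, y) (by simp only [Finset.mem_product]; exact ⟨hF, hx, hy⟩)
      have h2 : corr (fun h => headInf F h + ε₁) u₀ u₀ = corr (headInf F) u₀ u₀ + ε₁ := by
        simp only [corr, wsum_add_right, hu₀.isWeight.wsum_const]
      have h3 : corr (headInf F) u₀ u₀ ≤ meanVal d (headInf F) + ε₁ := by
        rw [← hu₀.isWeight.wsum_const (meanVal d (headInf F) + ε₁)]
        exact wsum_mono hu₀.isWeight.nonneg fun x _ => by
          linarith [(abs_le.1 (h₀ _ (Finset.mem_image_of_mem _ hF) x⁻¹)).2]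
      linarith
    obtain ⟨u, hu, h⟩ := ih (s.image headInf ∪ s.image (fun F => headCorr F v)) (by
      intro F' hF'
      rcases Finset.mem_union.1 hF' with hF' | hF'
      · obtain ⟨F, hF, rfl⟩ := Finset.mem_image.1 hF'
        exact (hs F hF).headInf
      · obtain ⟨F, hF, rfl⟩ := Finset.mem_image.1 hF'
        exact (hs F hF).headCorr hv) hε₁
    refine ⟨_, ⟨v, u, hv, hu, rfl⟩, fun F hF x => ?_⟩
    have hFs := hs F hF
    have hI := abs_le.1 (h _ (Finset.mem_union_left _ (Finset.mem_image_of_mem _ hF))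
      (fun i => x i.succ))
    have hP := abs_le.1 (h _ (Finset.mem_union_right _ (Finset.mem_image_of_mem _ hF))
      (fun i => x i.succ))
    have hm1 := hFs.meanVal_headInf_le
    have hm2 : meanVal (d + 1) F ≤ meanVal d (headInf F) + 2 * ε₁ := by
      refine (hFs.meanVal_le ⟨v, u₀, hv, hu₀, rfl⟩).trans ?_
      rw [corr_consWeight]
      exact hv_mean F hF
    have hm3 : meanVal d (headInf F) ≤ meanVal d (headCorr F v) :=
      le_meanVal fun w hw => (hFs.headInf.meanVal_le hw).trans
        (corr_mono hw.isWeight.nonneg fun _ _ _ _ => hFs.headInf_le hv _)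
    have hm4 : meanVal d (headCorr F v) ≤ meanVal d (headInf F) + 2 * ε₁ :=
      ((hFs.headCorr hv).meanVal_le hu₀).trans (hv_mean F hF)
    set t : Fin d → G := fun i => x i.succ with ht
    have hosc : ∀ k : Fin d → G,
        |wsum v (fun g => F (Fin.cons (x 0 * g) (t * k) : Fin (d + 1) → G))
          - headCorr F v (t * k)|
        ≤ δ * C + 4 / δ * (headCorr F v (t * k) - headInf F (t * k)) := by
      intro k
      have hp := hFs.1 (t * k)
      refine (hp.abs_wsum_sub_corr_le hv hδ
        (corr_sub_translate_le (η := headCorr F v (t * k) - headInf F (t * k)) hv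
          fun v' hv' => ?_) (x 0)).trans ?_
      · have := hFs.headInf_le hv' (t * k)
        simp only [headCorr] at this ⊢
        linarith
      · have := (hFs.apply_le_one (Fin.cons 1 (t * k) : Fin (d + 1) → G)).trans (hC F hF)
        have := mul_le_mul_of_nonneg_left this hδ.le
        rw [div_mul_eq_mul_div]
        linarith
    have hsum := hu.isWeight.abs_wsum_le hosc
    rw [wsum_sub_right, wsum_add_right, hu.isWeight.wsum_const, wsum_const_mul,
      wsum_sub_right] at hsum
    have hfin : 4 / δ * (wsum u (fun k => headCorr F v (t * k))
        - wsum u (fun k => headInf F (t * k))) ≤ ε / 4 := by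
      refine le_trans ?_ hε₁δ
      rw [div_mul_eq_mul_div]
      exact div_le_div_of_nonneg_right (by linarith [hI.1, hP.2]) hδ.le
    have hrw : wsum (consWeight v u) (fun k => F (x * k))
        = wsum u fun k => wsum v fun g => F (Fin.cons (x 0 * g) (t * k) : Fin (d + 1) → G) := by
      rw [wsum_consWeight, wsum_comm]
      simp only [mul_cons, ht]
    rw [hrw]
    have hs2 := abs_le.1 (hsum.trans (add_le_add hδC.le hfin))
    rw [abs_le]
    constructor <;> linarith [hI.1, hI.2, hP.1, hP.2, hs2.1, hs2.2]

end SeparatelyPositiveDefinite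

section Cubes

variable {G X : Type*}

lemma cubeMap_cons {d : ℕ} (T : Fin (d + 1) → G → X → X) (g : G) (h : Fin d → G) (b : Bool)
    (ε : Fin d → Bool) (x : X) :
    cubeMap T (Fin.cons g h : Fin (d + 1) → G) (Fin.cons b ε : Fin (d + 1) → Bool) x
      = (if b then T 0 g else id) (cubeMap (fun i => T i.succ) h ε x) := by
  simp [cubeMap, List.ofFn_succ]

lemma cubeMap_comm {d : ℕ} (T : Fin d → G → X → X) (h : Fin d → G) {S : X → X}
    (hS : ∀ i, S ∘ T i (h i) = T i (h i) ∘ S) (ε : Fin d → Bool) (x : X) :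
    cubeMap T h ε (S x) = S (cubeMap T h ε x) := by
  induction d generalizing x with
  | zero => simp [cubeMap]
  | succ d ih =>
    obtain ⟨g, h, rfl⟩ : ∃ g h', h = (Fin.cons g h' : Fin (d + 1) → G) :=
      ⟨h 0, fun i => h i.succ, (Fin.cons_self_tail h).symm⟩
    obtain ⟨b, ε, rfl⟩ : ∃ b ε', ε = (Fin.cons b ε' : Fin (d + 1) → Bool) :=
      ⟨ε 0, fun i => ε i.succ, (Fin.cons_self_tail ε).symm⟩
    rw [cubeMap_cons, cubeMap_cons, ih _ _ (fun i => by simpa using hS i.succ)]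
    cases b
    · rfl
    · exact (congrFun (hS 0) _).symm

lemma prod_cubeMap_cons {d : ℕ} (T : Fin (d + 1) → G → X → X) (f : X → ℝ) (g : G)
    (h : Fin d → G) (x : X) :
    ∏ ε : Fin (d + 1) → Bool, f (cubeMap T (Fin.cons g h : Fin (d + 1) → G) ε x)
      = ∏ ε : Fin d → Bool, f (cubeMap (fun i => T i.succ) h ε x)
          * f (T 0 g (cubeMap (fun i => T i.succ) h ε x)) := by
  rw [← (Fin.consEquiv fun _ : Fin (d + 1) => Bool).prod_comp, Fintype.prod_prod_type,
    Fintype.prod_bool, ← Finset.prod_mul_distrib]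
  refine Finset.prod_congr rfl fun ε _ => ?_
  rw [mul_comm]
  exact congrArg₂ (· * ·) (congrArg f (cubeMap_cons T g h false ε x))
    (congrArg f (cubeMap_cons T g h true ε x))

lemma abs_prod_cubeMap_le {d : ℕ} (T : Fin d → G → X → X) {f : X → ℝ} {C : ℝ}
    (hC : ∀ x, |f x| ≤ C) (h : Fin d → G) (x : X) :
    |∏ ε : Fin d → Bool, f (cubeMap T h ε x)| ≤ C ^ (2 ^ d) := by
  rw [Finset.abs_prod]
  refine (Finset.prod_le_prod (fun _ _ => abs_nonneg _) fun ε _ => hC _).trans_eq ?_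
  simp

variable [MeasurableSpace X]

/-- The integral of the product of `f` over the vertices of a cube. -/
noncomputable def cubeIntegral {d : ℕ} (μ : Measure X) (T : Fin d → G → X → X) (f : X → ℝ)
    (g : Fin d → G) : ℝ :=
  ∫ x, ∏ ε : Fin d → Bool, f (cubeMap T g ε x) ∂μ

lemma cubeIntegral_cons {d : ℕ} (μ : Measure X) (T : Fin (d + 1) → G → X → X) (f : X → ℝ)
    (g : G) (h : Fin d → G) :
    cubeIntegral μ T f (Fin.cons g h : Fin (d + 1) → G)
      = cubeIntegral μ (fun i => T i.succ) (fun x => f x * f (T 0 g x)) h := by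
  simp only [cubeIntegral, prod_cubeMap_cons]

variable [Group G]

/-- Pairwise commuting measure-preserving actions of a group. -/
structure IsCommutingAction {d : ℕ} (μ : Measure X) (T : Fin d → G → X → X) : Prop where
  mp : ∀ i g, MeasurePreserving (T i g) μ μ
  hom : ∀ i g h, T i (g * h) = T i g ∘ T i h
  comm : ∀ i j, i ≠ j → ∀ g h, T i g ∘ T j h = T j h ∘ T i g

lemma IsCommutingAction.tail {d : ℕ} {μ : Measure X} {T : Fin (d + 1) → G → X → X}
    (hT : IsCommutingAction μ T) : IsCommutingAction μ fun i : Fin d => T i.succ :=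
  ⟨fun i => hT.mp i.succ, fun i => hT.hom i.succ,
    fun i j hij => hT.comm i.succ j.succ (by simpa using hij)⟩

lemma measurable_cubeMap {d : ℕ} {μ : Measure X} {T : Fin d → G → X → X}
    (hT : IsCommutingAction μ T) (h : Fin d → G) (ε : Fin d → Bool) :
    Measurable (cubeMap T h ε) := by
  induction d with
  | zero => exact measurable_id
  | succ d ih =>
    obtain ⟨g, h, rfl⟩ : ∃ g h', h = (Fin.cons g h' : Fin (d + 1) → G) :=
      ⟨h 0, fun i => h i.succ, (Fin.cons_self_tail h).symm⟩
    obtain ⟨b, ε, rfl⟩ : ∃ b ε', ε = (Fin.cons b ε' : Fin (d + 1) → Bool) :=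
      ⟨ε 0, fun i => ε i.succ, (Fin.cons_self_tail ε).symm⟩
    have e : cubeMap T (Fin.cons g h : Fin (d + 1) → G) (Fin.cons b ε : Fin (d + 1) → Bool)
        = (if b then T 0 g else id) ∘ cubeMap (fun i => T i.succ) h ε :=
      funext fun x => cubeMap_cons T g h b ε x
    rw [e]
    refine Measurable.comp ?_ (ih hT.tail h ε)
    split_ifs
    exacts [(hT.mp 0 g).measurable, measurable_id]

lemma cubeIntegral_cons_inv_mul {d : ℕ} {μ : Measure X} {T : Fin (d + 1) → G → X → X}
    (hT : IsCommutingAction μ T) {f : X → ℝ} (hf : Measurable f) (a b : G) (h : Fin d → G) :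
    cubeIntegral μ T f (Fin.cons (a⁻¹ * b) h : Fin (d + 1) → G)
      = ∫ x, (∏ ε, f (cubeMap (fun i => T i.succ) h ε (T 0 a⁻¹ x)))
          * ∏ ε, f (cubeMap (fun i => T i.succ) h ε (T 0 b⁻¹ x)) ∂μ := by
  have hmeas : Measurable fun x => ∏ ε, f (cubeMap (fun i => T i.succ) h ε x) :=
    Finset.measurable_fun_prod _ fun ε _ => hf.comp (measurable_cubeMap hT.tail h ε)
  have e : ∀ x, ∏ ε, f (cubeMap T (Fin.cons (a⁻¹ * b) h : Fin (d + 1) → G) ε x)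
      = (∏ ε, f (cubeMap (fun i => T i.succ) h ε x))
        * ∏ ε, f (cubeMap (fun i => T i.succ) h ε (T 0 (a⁻¹ * b) x)) := fun x => by
    rw [prod_cubeMap_cons, Finset.prod_mul_distrib]
    congr 1
    refine Finset.prod_congr rfl fun ε _ => ?_
    rw [cubeMap_comm _ _ (fun i => hT.comm 0 i.succ (Fin.succ_ne_zero i).symm _ _)]
  simp only [cubeIntegral, e]
  have hmap := (hT.mp 0 b⁻¹).map_eq
  conv_lhs => rw [← hmap]
  have hmeas2 : Measurable fun x => (∏ ε, f (cubeMap (fun i => T i.succ) h ε x))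
      * ∏ ε, f (cubeMap (fun i => T i.succ) h ε (T 0 (a⁻¹ * b) x)) :=
    hmeas.mul (hmeas.comp (hT.mp 0 (a⁻¹ * b)).measurable)
  rw [integral_map (hT.mp 0 b⁻¹).measurable.aemeasurable hmeas2.aestronglyMeasurable]
  refine integral_congr_ae (Eventually.of_forall fun x => ?_)
  have : T 0 (a⁻¹ * b) (T 0 b⁻¹ x) = T 0 a⁻¹ x := by
    rw [← Function.comp_apply (f := T 0 (a⁻¹ * b)), ← hT.hom, mul_inv_cancel_right]
  simp only [this]
  rw [mul_comm]

lemma integral_wsum {ι : Type*} {μ : Measure X} (a : ι →₀ ℝ) (K : ι → X → ℝ)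
    (hK : ∀ i, Integrable (K i) μ) :
    ∫ x, wsum a (fun i => K i x) ∂μ = wsum a fun i => ∫ x, K i x ∂μ := by
  simp only [wsum_eq_sum]
  rw [integral_finsetSum _ fun i _ => (hK i).const_mul _]
  simp only [integral_const_mul]

variable {μ : Measure X} [IsProbabilityMeasure μ]

lemma integrable_of_abs_le {φ : X → ℝ} (hφ : Measurable φ) {C : ℝ} (hC : ∀ x, |φ x| ≤ C) :
    Integrable φ μ :=
  Integrable.of_bound hφ.aestronglyMeasurable C (Eventually.of_forall hC)

lemma corr_cubeIntegral_cons {d : ℕ} {T : Fin (d + 1) → G → X → X}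
    (hT : IsCommutingAction μ T) {f : X → ℝ} (hf : Measurable f) {C : ℝ}
    (hC : ∀ x, |f x| ≤ C) (h : Fin d → G) (a : G →₀ ℝ) :
    corr (fun g => cubeIntegral μ T f (Fin.cons g h : Fin (d + 1) → G)) a a
      = ∫ x, wsum a (fun g => ∏ ε, f (cubeMap (fun i => T i.succ) h ε (T 0 g⁻¹ x))) ^ 2 ∂μ := by
  set K : G → X → ℝ := fun g x => ∏ ε, f (cubeMap (fun i => T i.succ) h ε (T 0 g⁻¹ x)) with hKdef
  have hKm : ∀ g, Measurable (K g) := fun g =>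
    Finset.measurable_fun_prod _ fun ε _ =>
      hf.comp ((measurable_cubeMap hT.tail h ε).comp (hT.mp 0 _).measurable)
  have hKb : ∀ g x, |K g x| ≤ C ^ (2 ^ d) := fun g x => abs_prod_cubeMap_le _ hC h _
  have hKK : ∀ g g', Integrable (fun x => K g x * K g' x) μ := fun g g' =>
    integrable_of_abs_le ((hKm g).mul (hKm g')) (C := C ^ (2 ^ d) * C ^ (2 ^ d)) fun x => by
      rw [abs_mul]
      exact mul_le_mul (hKb g x) (hKb g' x) (abs_nonneg _) ((abs_nonneg _).trans (hKb g x))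
  have e : ∀ x, wsum a (fun g => K g x) ^ 2
      = wsum a fun g => wsum a fun g' => K g x * K g' x := fun x => by
    simp only [wsum_const_mul, wsum_mul_const, sq]
  change corr _ a a = ∫ x, wsum a (fun g => K g x) ^ 2 ∂μ
  simp only [e]
  rw [integral_wsum a _ fun g => by
    simp only [wsum_eq_sum]
    exact integrable_finsetSum _ fun g' _ => (hKK g g').const_mul _]
  have hsum : ∀ g, ∫ x, wsum a (fun g' => K g x * K g' x) ∂μ
      = wsum a fun g' => ∫ x, K g x * K g' x ∂μ := fun g =>
    integral_wsum a (fun g' x => K g x * K g' x) (hKK g)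
  simp only [hsum]
  simp only [corr, cubeIntegral_cons_inv_mul hT hf, hKdef]

lemma sepPosDef_cubeIntegral {d : ℕ} {T : Fin d → G → X → X}
    (hT : IsCommutingAction μ T) {f : X → ℝ} (hf : Measurable f) {C : ℝ}
    (hC : ∀ x, |f x| ≤ C) (hf0 : ∀ x, 0 ≤ f x) : SepPosDef d (cubeIntegral μ T f) := by
  induction d generalizing f C with
  | zero => exact integral_nonneg fun x => Finset.prod_nonneg fun ε _ => hf0 _
  | succ d ih =>
    refine ⟨fun h => ⟨fun g => ?_, fun a => ?_⟩, fun g => ?_⟩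
    · have h1 := cubeIntegral_cons_inv_mul hT hf g 1 h
      have h2 := cubeIntegral_cons_inv_mul hT hf 1 g h
      simp only [mul_one, inv_one, one_mul] at h1 h2
      rw [h1, h2]
      simp only [mul_comm]
    · rw [corr_cubeIntegral_cons hT hf hC]
      exact integral_nonneg fun x => sq_nonneg _
    · simp only [cubeIntegral_cons]
      refine ih hT.tail (hf.mul (hf.comp (hT.mp 0 g).measurable)) (C := C * C) (fun x => ?_)
        fun x => mul_nonneg (hf0 _) (hf0 _)
      rw [abs_mul]
      exact mul_le_mul (hC _) (hC _) (abs_nonneg _) ((abs_nonneg _).trans (hC x))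

lemma sq_cubeIntegral_tail_le {d : ℕ} {T : Fin (d + 1) → G → X → X}
    (hT : IsCommutingAction μ T) {f : X → ℝ} (hf : Measurable f) {C : ℝ}
    (hC : ∀ x, |f x| ≤ C) {v : G →₀ ℝ} (hv : IsWeight v) (h : Fin d → G) :
    cubeIntegral μ (fun i => T i.succ) f h ^ 2 ≤ headCorr (cubeIntegral μ T f) v h := by
  rw [headCorr, corr_cubeIntegral_cons hT hf hC]
  set K : G → X → ℝ := fun g x => ∏ ε, f (cubeMap (fun i => T i.succ) h ε (T 0 g⁻¹ x)) with hKdef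
  have hHm : Measurable fun x => ∏ ε, f (cubeMap (fun i => T i.succ) h ε x) :=
    Finset.measurable_fun_prod _ fun ε _ => hf.comp (measurable_cubeMap hT.tail h ε)
  have hKm : ∀ g, Measurable (K g) := fun g => hHm.comp (hT.mp 0 _).measurable
  have hKb : ∀ g x, |K g x| ≤ C ^ (2 ^ d) := fun g x => abs_prod_cubeMap_le _ hC h _
  have hKi : ∀ g, ∫ x, K g x ∂μ = cubeIntegral μ (fun i => T i.succ) f h := fun g => by
    rw [cubeIntegral, ← integral_map (hT.mp 0 g⁻¹).measurable.aemeasurable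
      (f := fun x => ∏ ε, f (cubeMap (fun i => T i.succ) h ε x))
      hHm.aestronglyMeasurable, (hT.mp 0 g⁻¹).map_eq]
  have hWm : Measurable fun x => wsum v fun g => K g x := by
    simp only [wsum_eq_sum]
    exact Finset.measurable_fun_sum _ fun g _ => (hKm g).const_mul _
  have hWb : ∀ x, |wsum v fun g => K g x| ≤ C ^ (2 ^ d) := fun x =>
    (hv.abs_wsum_le fun g => hKb g x).trans_eq (hv.wsum_const _)
  have hW : ∫ x, wsum v (fun g => K g x) ∂μ = cubeIntegral μ (fun i => T i.succ) f h := by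
    rw [integral_wsum v K fun g => integrable_of_abs_le (hKm g) (hKb g)]
    simp only [hKi, hv.wsum_const]
  rw [← hW]
  set W : X → ℝ := fun x => wsum v fun g => K g x
  set c := ∫ x, W x ∂μ with hc
  have hWint : Integrable W μ := integrable_of_abs_le hWm hWb
  have hW2 : Integrable (fun x => W x ^ 2) μ :=
    integrable_of_abs_le (hWm.pow_const 2) (C := (C ^ (2 ^ d)) ^ 2) fun x => by
      rw [abs_pow]
      exact pow_le_pow_left₀ (abs_nonneg _) (hWb x) 2
  have hle : ∫ x, (2 * c * W x - c ^ 2) ∂μ ≤ ∫ x, W x ^ 2 ∂μ :=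
    integral_mono ((hWint.const_mul _).sub (integrable_const _)) hW2
      fun x => by nlinarith [sq_nonneg (W x - c)]
  rw [integral_sub (hWint.const_mul _) (integrable_const _), integral_const_mul, ← hc] at hle
  simp only [integral_const, probReal_univ, one_smul] at hle
  linarith

lemma pow_integral_le_corr_cubeIntegral {d : ℕ} {T : Fin d → G → X → X}
    (hT : IsCommutingAction μ T) {f : X → ℝ} (hf : Measurable f) {C : ℝ}
    (hC : ∀ x, |f x| ≤ C) (hf0 : ∀ x, 0 ≤ f x) {u : (Fin d → G) →₀ ℝ}
    (hu : IsProdWeight d u) :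
    (∫ x, f x ∂μ) ^ (2 ^ d) ≤ corr (cubeIntegral μ T f) u u := by
  induction d with
  | zero =>
    rw [hu]
    simp [corr, wsum_single, cubeIntegral, cubeMap]
  | succ d ih =>
    obtain ⟨v, u, hv, hu, rfl⟩ := hu
    have huw := hu.isWeight
    rw [corr_consWeight, pow_succ 2 d, pow_mul]
    calc ((∫ x, f x ∂μ) ^ 2 ^ d) ^ 2
        ≤ corr (cubeIntegral μ (fun i => T i.succ) f) u u ^ 2 :=
          pow_le_pow_left₀ (pow_nonneg (integral_nonneg hf0) _) (ih hT.tail hu) 2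
      _ ≤ corr (fun h => cubeIntegral μ (fun i => T i.succ) f h ^ 2) u u :=
          (huw.sq_wsum_le _).trans (wsum_mono huw.nonneg fun _ _ => huw.sq_wsum_le _)
      _ ≤ corr (headCorr (cubeIntegral μ T f) v) u u :=
          corr_mono huw.nonneg fun _ _ _ _ => sq_cubeIntegral_tail_le hT hf hC hv _

end Cubes

/-- For a nonnegative bounded measurable `f` and every `c > 0`, the set of
`(g₁, …, g_d) ∈ G^d` for which `∫ ∏_{ε ∈ {0,1}ᵈ} f ∘ ∏ᵢ (T⁽ⁱ⁾_{gᵢ})^{εᵢ} dμ`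
exceeds `(∫ f dμ)^{2^d} - c` is both left and right syndetic in `G^d`. -/
theorem cube_integral_large_syndetic
    {G X : Type*} [Group G] [Countable G] [DecidableEq G]
    [MeasurableSpace X] (μ : MeasureTheory.Measure X) [MeasureTheory.IsProbabilityMeasure μ]
    (hG : ∃ Φ : ℕ → Finset G, IsTwoSidedFolner Φ)
    (d : ℕ) (T : Fin d → G → X → X)
    (hT_mp : ∀ i g, MeasureTheory.MeasurePreserving (T i g) μ μ)
    (hT_bij : ∀ i g, Function.Bijective (T i g))
    (hT_hom : ∀ i g h, T i (g * h) = T i g ∘ T i h)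
    (hT_comm : ∀ i j, i ≠ j → ∀ g h, T i g ∘ T j h = T j h ∘ T i g)
    (f : X → ℝ) (hf_meas : Measurable f) (hf_bdd : ∃ C, ∀ x, |f x| ≤ C)
    (hf_nonneg : ∀ x, 0 ≤ f x) :
    ∀ c > (0 : ℝ),
      LeftSyndetic {g : Fin d → G |
        (∫ x, f x ∂μ) ^ (2 ^ d) - c <
          ∫ x, ∏ ε : Fin d → Bool, f (cubeMap T g ε x) ∂μ} ∧
      RightSyndetic {g : Fin d → G |
        (∫ x, f x ∂μ) ^ (2 ^ d) - c <
          ∫ x, ∏ ε : Fin d → Bool, f (cubeMap T g ε x) ∂μ} := by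
  intro c hc
  obtain ⟨C, hC⟩ := hf_bdd
  have hT : IsCommutingAction μ T := ⟨hT_mp, hT_hom, hT_comm⟩
  have hF := sepPosDef_cubeIntegral hT hf_meas hC hf_nonneg
  obtain ⟨u, hu, h⟩ := exists_isProdWeight_abs_wsum_sub_meanVal_le d {cubeIntegral μ T f}
    (fun F hFm => by rwa [Finset.mem_singleton.1 hFm]) (half_pos hc)
  have hmean : (∫ x, f x ∂μ) ^ (2 ^ d) ≤ meanVal d (cubeIntegral μ T f) :=
    le_meanVal fun w hw => pow_integral_le_corr_cubeIntegral hT hf_meas hC hf_nonneg hw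
  have key : ∀ x : Fin d → G, ∃ k ∈ u.support,
      (∫ x, f x ∂μ) ^ (2 ^ d) - c < cubeIntegral μ T f (x * k) := by
    intro x
    by_contra! hle
    have h1 := wsum_mono hu.isWeight.nonneg hle
    rw [hu.isWeight.wsum_const] at h1
    linarith [(abs_le.1 (h _ (Finset.mem_singleton_self _) x)).1]
  classical
  refine ⟨⟨u.support, fun x => ?_⟩, ⟨u.support.image (·⁻¹), fun x => ?_⟩⟩
  · obtain ⟨k, hk, h⟩ := key x⁻¹
    refine ⟨k, hk, ?_⟩
    rw [← hF.apply_inv, mul_inv_rev, inv_inv] at h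
    exact h
  · obtain ⟨k, hk, h⟩ := key x
    refine ⟨k⁻¹, Finset.mem_image_of_mem _ hk, ?_⟩
    rw [inv_inv]
    exact h
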